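/- (Second-order estimate for simple splashes, all α ∈ (0,1)) Let α ∈ (0,1), γ ∈ (2α−1, 1], and A, R > 0, c ∈ ℝ. Then there is a constant C, depending only on α, γ, A, R, with the following property. Let f : [−R,R] → ℝ satisfy |f(h) − f(0) − (c/2) h²| ≤ A|h|^{2+γ} for all h ∈ [−R,R]. Then for every m ∈ (0, R/2], the iterated integral J := ∫_{−R}^{R} ∫_{f(0)+(c/2)h²}^{f(h)} [ h/(h²+v²)^{1+α} − h/(h²+(v−m)²)^{1+α} ] dv dh satisfies |J| ≤ C m. -/

import Mathlib

open Real MeasureTheory Set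

noncomputable section

/-- The g-SQG patch kernel `K_m(h,v) = h/(h²+v²)^{1+α} − h/(h²+(v−m)²)^{1+α}`. -/
def Km (α m h v : ℝ) : ℝ :=
  h / (h ^ 2 + v ^ 2) ^ (1 + α) - h / (h ^ 2 + (v - m) ^ 2) ^ (1 + α)

lemma abs_rpow_ii (r R : ℝ) (hr : -1 < r) (hR : 0 < R) :
    IntervalIntegrable (fun h : ℝ => |h| ^ r) volume (-R) R := by
  have h1 : IntervalIntegrable (fun h : ℝ => |h| ^ r) volume 0 R := by
    refine (intervalIntegral.intervalIntegrable_rpow' (a := 0) (b := R) hr).congr ?_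
    intro x hx
    rw [uIoc_of_le hR.le] at hx
    simp only [abs_of_pos hx.1]
  have h2 : IntervalIntegrable (fun h : ℝ => |h| ^ r) volume (-R) 0 := by
    have := (IntervalIntegrable.comp_sub_left h1 0).symm
    simpa using this
  exact h2.trans h1

lemma Km_bound (α m h v : ℝ) (hα0 : 0 < α) (hm : 0 < m) (hh : h ≠ 0) :
    |Km α m h v| ≤ 2 * (1 + α) * (h ^ 2) ^ (-(1 + α)) * m := by
  have hh2 : 0 < h ^ 2 := by positivity
  have hd : ∀ x ∈ (univ : Set ℝ), HasDerivWithinAt (fun v : ℝ => h * (h ^ 2 + v ^ 2) ^ (-(1 + α)))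
      (h * (2 * x * (-(1 + α)) * (h ^ 2 + x ^ 2) ^ (-(1 + α) - 1))) univ x := by
    intro x _
    have hp : 0 < h ^ 2 + x ^ 2 := by positivity
    have h0 : HasDerivAt (fun v : ℝ => h ^ 2 + v ^ 2) (2 * x) x := by
      simpa using (hasDerivAt_pow 2 x).const_add (h ^ 2)
    exact ((h0.rpow_const (Or.inl hp.ne')).const_mul h).hasDerivWithinAt
  have hb : ∀ x ∈ (univ : Set ℝ), ‖h * (2 * x * (-(1 + α)) * (h ^ 2 + x ^ 2) ^ (-(1 + α) - 1))‖
      ≤ 2 * (1 + α) * (h ^ 2) ^ (-(1 + α)) := by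
    intro x _
    have hp : 0 < h ^ 2 + x ^ 2 := by positivity
    have e : ‖h * (2 * x * (-(1 + α)) * (h ^ 2 + x ^ 2) ^ (-(1 + α) - 1))‖
        = 2 * (1 + α) * (|h| * |x| * (h ^ 2 + x ^ 2) ^ (-(1 + α) - 1)) := by
      rw [Real.norm_eq_abs, abs_mul, abs_mul, abs_mul, abs_mul, abs_neg,
        abs_of_pos (by positivity : (0:ℝ) < 1 + α), abs_of_pos (Real.rpow_pos_of_pos hp _)]
      norm_num
      ring
    rw [e]
    have h3 : |h| * |x| ≤ h ^ 2 + x ^ 2 := by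
      rw [← sq_abs h, ← sq_abs x]; nlinarith [sq_nonneg (|h| - |x|), sq_nonneg (|h| + |x|)]
    have h4 : |h| * |x| * (h ^ 2 + x ^ 2) ^ (-(1 + α) - 1) ≤ (h ^ 2 + x ^ 2) ^ (-(1 + α)) := by
      calc _ ≤ (h ^ 2 + x ^ 2) * (h ^ 2 + x ^ 2) ^ (-(1 + α) - 1) := by gcongr
        _ = _ := by rw [Real.rpow_sub_one hp.ne']; field_simp
    have h5 : (h ^ 2 + x ^ 2) ^ (-(1 + α)) ≤ (h ^ 2) ^ (-(1 + α)) :=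
      Real.rpow_le_rpow_of_nonpos hh2 (by nlinarith [sq_nonneg x]) (by linarith)
    have := h4.trans h5
    gcongr
  have key := convex_univ.norm_image_sub_le_of_norm_hasDerivWithin_le hd hb
    (mem_univ (v - m)) (mem_univ v)
  have e2 : Km α m h v = h * (h ^ 2 + v ^ 2) ^ (-(1 + α))
      - h * (h ^ 2 + (v - m) ^ 2) ^ (-(1 + α)) := by
    rw [Km, Real.rpow_neg (by positivity), Real.rpow_neg (by positivity)]
    simp only [div_eq_mul_inv]
  rw [e2]
  simpa [Real.norm_eq_abs, abs_of_pos hm] using key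

/-- (Second-order estimate for simple splashes, all `α ∈ (0,1)`) Let `α ∈ (0,1)`,
`γ ∈ (2α−1,1]`, and `A, R > 0`. There is a constant `C = C(α,γ,A,R)` such that for every
`c ∈ ℝ` and `f : [−R,R] → ℝ` with `|f(h) − f(0) − (c/2)h²| ≤ A|h|^{2+γ}` on `[−R,R]`, and
every `m ∈ (0,R/2]`, the iterated integral
`J = ∫_{−R}^{R} ∫_{f(0)+(c/2)h²}^{f(h)} K_m(h,v) dv dh` satisfies `|J| ≤ Cm`. -/
theorem second_order_J2_estimate (α γ A R : ℝ) (hα0 : 0 < α) (hα : α < 1)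
    (hγ1 : 2 * α - 1 < γ) (hγ2 : γ ≤ 1) (hA : 0 < A) (hR : 0 < R) :
    ∃ C : ℝ, ∀ (c : ℝ) (f : ℝ → ℝ),
      (∀ h ∈ Icc (-R) R, |f h - f 0 - c / 2 * h ^ 2| ≤ A * |h| ^ (2 + γ)) →
      ∀ m : ℝ, 0 < m → m ≤ R / 2 →
        |∫ h in (-R)..R, ∫ v in (f 0 + c / 2 * h ^ 2)..(f h), Km α m h v| ≤ C * m := by
  refine ⟨2 * (1 + α) * A * ∫ h in (-R)..R, |h| ^ (γ - 2 * α), ?_⟩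
  intro c f hf m hm _
  have hint := abs_rpow_ii (γ - 2 * α) R (by linarith) hR
  have key := intervalIntegral.norm_integral_le_of_norm_le (μ := volume)
    (f := fun h => ∫ v in (f 0 + c / 2 * h ^ 2)..(f h), Km α m h v)
    (g := fun h => 2 * (1 + α) * A * m * |h| ^ (γ - 2 * α)) (a := -R) (b := R) (by linarith)
    (by
      refine Filter.Eventually.of_forall fun h hh => ?_
      by_cases h0 : h = 0
      · subst h0
        simp only [Km, zero_div, sub_zero, intervalIntegral.integral_zero, norm_zero]
        positivity
      have hpos : 0 < |h| := abs_pos.mpr h0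
      have h1 := intervalIntegral.norm_integral_le_of_norm_le_const
        (a := f 0 + c / 2 * h ^ 2) (b := f h) (f := fun v => Km α m h v)
        (fun v _ => Km_bound α m h v hα0 hm h0)
      have h2 := hf h ⟨hh.1.le, hh.2⟩
      rw [← sub_sub] at h1
      refine h1.trans ?_
      calc _ ≤ 2 * (1 + α) * (h ^ 2) ^ (-(1 + α)) * m * (A * |h| ^ (2 + γ)) := by gcongr
        _ = 2 * (1 + α) * A * m * ((h ^ 2) ^ (-(1 + α)) * |h| ^ (2 + γ)) := by ring
        _ = _ := by
          congr 1
          rw [← sq_abs, ← Real.rpow_natCast, ← Real.rpow_mul hpos.le, ← Real.rpow_add hpos]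
          congr 1
          push_cast
          ring)
    (hint.const_mul _)
  rw [intervalIntegral.integral_const_mul, Real.norm_eq_abs] at key
  refine key.trans (le_of_eq ?_)
  ring

end
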